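/- The functional equation F(x,y) = 1 - (x/y)F(x,0) + (x/(y(1-y)))·F(x,y) with F(x,0) = (1-√(1-4x))/(2x) has solution F(x,y) = (1-y)(1-2y-√(1-4x))/(2(x-y+y²)), and its power series coefficients are [xⁿ y^m]F(x,y) = (m+2)(2n+m-1)!/((n-1)!(n+m+1)!) for n ≥ 1, m ≥ 0. -/

import Mathlib

/-- The coefficient of `x ^ k` in the `(m + 1)`-st power of the Catalan generating function. -/
noncomputable def catalanPowCoeff (m k : ℕ) : ℝ :=
  ((m + 1) * Nat.factorial (2 * k + m) : ℝ) / (Nat.factorial k * Nat.factorial (k + m + 1))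

theorem catalanPowCoeff_nonneg (m k : ℕ) : 0 ≤ catalanPowCoeff m k := by
  unfold catalanPowCoeff
  positivity

theorem catalanPowCoeff_zero_right (m : ℕ) : catalanPowCoeff m 0 = 1 := by
  simp only [catalanPowCoeff, Nat.mul_zero, Nat.zero_add, Nat.factorial_succ, Nat.factorial_zero]
  push_cast
  rw [one_mul, div_self (by positivity)]

theorem catalanPowCoeff_add (m k : ℕ) :
    catalanPowCoeff m (k + 1) + catalanPowCoeff (m + 2) k = catalanPowCoeff (m + 1) (k + 1) := by
  unfold catalanPowCoeff
  rw [show 2 * (k + 1) + m = 2 * k + m + 2 by ring, show k + 1 + m + 1 = k + m + 2 by ring,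
    show 2 * k + (m + 2) = 2 * k + m + 2 by ring, show k + (m + 2) + 1 = k + m + 2 + 1 by ring,
    show 2 * (k + 1) + (m + 1) = 2 * k + m + 2 + 1 by ring,
    show k + 1 + (m + 1) + 1 = k + m + 2 + 1 by ring, Nat.factorial_succ (k + m + 2),
    Nat.factorial_succ (2 * k + m + 2), Nat.factorial_succ k]
  push_cast
  field_simp
  ring

theorem catalanPowCoeff_zero_left (k : ℕ) : catalanPowCoeff 0 k = catalan k := by
  have h := Nat.succ_mul_centralBinom_succ k
  have hc : ((k + 1 : ℕ) : ℝ) * catalan k = Nat.centralBinom k := by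
    exact_mod_cast succ_mul_catalan_eq_centralBinom k
  have hb : (Nat.centralBinom k : ℝ) * (Nat.factorial k * Nat.factorial k)
      = Nat.factorial (2 * k) := by
    have := Nat.choose_mul_factorial_mul_factorial (show k ≤ 2 * k by omega)
    rw [show 2 * k - k = k by omega, ← Nat.centralBinom_eq_two_mul_choose, mul_assoc] at this
    exact_mod_cast this
  simp only [catalanPowCoeff, Nat.add_zero, Nat.factorial_succ]
  rw [div_eq_iff (by positivity), ← hb, ← hc]
  push_cast
  ring

theorem catalanPowCoeff_one_left (k : ℕ) : catalanPowCoeff 1 k = catalanPowCoeff 0 (k + 1) := by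
  unfold catalanPowCoeff
  rw [show 2 * (k + 1) + 0 = 2 * k + 1 + 1 by ring, show k + 1 + 0 + 1 = k + 1 + 1 by ring,
    Nat.factorial_succ (2 * k + 1), Nat.factorial_succ k]
  push_cast
  field_simp
  ring

theorem sum_range_catalan_mul_pow (N : ℕ) :
    ∑ n ∈ Finset.range N, (catalan n : ℝ) * (1 / 4) ^ n
      = 2 * (1 - Nat.centralBinom N * (1 / 4) ^ N) := by
  induction N with
  | zero => simp
  | succ N ih =>
    have hc : ((N : ℝ) + 1) * catalan N = Nat.centralBinom N := by
      exact_mod_cast succ_mul_catalan_eq_centralBinom N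
    have hs : ((N : ℝ) + 1) * Nat.centralBinom (N + 1)
        = 2 * (2 * N + 1) * Nat.centralBinom N := by
      exact_mod_cast Nat.succ_mul_centralBinom_succ N
    have hs' : (Nat.centralBinom (N + 1) : ℝ) = 2 * (2 * N + 1) * catalan N := by
      have : (N : ℝ) + 1 ≠ 0 := by positivity
      apply mul_left_cancel₀ this
      rw [hs, ← hc]
      ring
    rw [Finset.sum_range_succ, ih, hs', ← hc]
    ring

theorem sum_catalan_mul_pow_le_two (s : Finset ℕ) :
    ∑ n ∈ s, (catalan n : ℝ) * (1 / 4) ^ n ≤ 2 := by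
  obtain ⟨N, hN⟩ := s.exists_nat_subset_range
  calc ∑ n ∈ s, (catalan n : ℝ) * (1 / 4) ^ n
      ≤ ∑ n ∈ Finset.range N, (catalan n : ℝ) * (1 / 4) ^ n :=
        Finset.sum_le_sum_of_subset_of_nonneg hN fun _ _ _ => by positivity
    _ ≤ 2 := by
        rw [sum_range_catalan_mul_pow]
        have : (0 : ℝ) ≤ Nat.centralBinom N * (1 / 4) ^ N := by positivity
        linarith

theorem summable_catalan_mul_pow_quarter :
    Summable fun n : ℕ => (catalan n : ℝ) * (1 / 4) ^ n :=
  summable_of_sum_le (fun _ => by positivity) sum_catalan_mul_pow_le_two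

theorem norm_catalan_mul_pow_le {x : ℝ} (hx : |x| ≤ 1 / 4) (n : ℕ) :
    ‖(catalan n : ℝ) * x ^ n‖ ≤ catalan n * (1 / 4) ^ n := by
  rw [norm_mul, norm_pow, Real.norm_natCast, Real.norm_eq_abs]
  gcongr

theorem summable_norm_catalan_mul_pow {x : ℝ} (hx : |x| ≤ 1 / 4) :
    Summable fun n : ℕ => ‖(catalan n : ℝ) * x ^ n‖ :=
  .of_nonneg_of_le (fun _ => norm_nonneg _) (norm_catalan_mul_pow_le hx)
    summable_catalan_mul_pow_quarter

/-- The Catalan generating function as a real function. -/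
noncomputable def catalanSum (x : ℝ) : ℝ := ∑' n : ℕ, (catalan n : ℝ) * x ^ n

theorem hasSum_catalanSum {x : ℝ} (hx : |x| ≤ 1 / 4) :
    HasSum (fun n : ℕ => (catalan n : ℝ) * x ^ n) (catalanSum x) :=
  (summable_norm_catalan_mul_pow hx).of_norm.hasSum

theorem abs_catalanSum_le_two {x : ℝ} (hx : |x| ≤ 1 / 4) : |catalanSum x| ≤ 2 :=
  (tsum_of_norm_bounded summable_catalan_mul_pow_quarter.hasSum (norm_catalan_mul_pow_le hx)).trans
    (summable_catalan_mul_pow_quarter.tsum_le_of_sum_le sum_catalan_mul_pow_le_two)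

theorem catalanSum_eq {x : ℝ} (hx : |x| ≤ 1 / 4) :
    catalanSum x = 1 + x * catalanSum x ^ 2 := by
  have hn := summable_norm_catalan_mul_pow hx
  have h0 := hn.of_norm.tsum_eq_zero_add
  rw [sq]
  conv_rhs => rw [catalanSum, tsum_mul_tsum_eq_tsum_sum_antidiagonal_of_summable_norm hn hn,
    ← tsum_mul_left]
  rw [catalanSum, h0]
  congr 1
  · simp
  · congr 1
    ext n
    rw [catalan_succ', Nat.cast_sum, Finset.sum_mul, Finset.mul_sum]
    refine Finset.sum_congr rfl fun p hp => ?_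
    rw [← Finset.HasAntidiagonal.mem_antidiagonal.1 hp]
    push_cast
    ring

theorem sqrt_one_sub_four_mul {x : ℝ} (hx : |x| ≤ 1 / 4) :
    Real.sqrt (1 - 4 * x) = 1 - 2 * (x * catalanSum x) := by
  have h : |x * catalanSum x| ≤ 1 / 4 * 2 := by
    rw [abs_mul]
    exact mul_le_mul hx (abs_catalanSum_le_two hx) (abs_nonneg _) (by norm_num)
  rw [show 1 - 4 * x = (1 - 2 * (x * catalanSum x)) ^ 2 by
    linear_combination 4 * x * catalanSum_eq hx, Real.sqrt_sq]
  linarith [le_abs_self (x * catalanSum x)]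

theorem HasSum.of_forall_eq {ι : Type*} {f g : ι → ℝ} {a b : ℝ} (h : HasSum f a)
    (hf : ∀ i, g i = f i) (hb : b = a) : HasSum g b := by
  rwa [funext hf, hb]

theorem hasSum_catalanPowCoeff {x : ℝ} (hx : |x| ≤ 1 / 4) (m : ℕ) :
    HasSum (fun k : ℕ => catalanPowCoeff m k * x ^ k) (catalanSum x ^ (m + 1)) := by
  rcases eq_or_ne x 0 with rfl | hx0
  · have h1 : catalanSum 0 = 1 := by simpa using catalanSum_eq hx
    rw [h1, one_pow]
    convert hasSum_single (f := fun k : ℕ => catalanPowCoeff m k * (0 : ℝ) ^ k) 0 ?_ using 1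
    · simp [catalanPowCoeff_zero_right]
    · intro k hk
      simp [hk]
  have hS := catalanSum_eq hx
  have h0 : HasSum (fun k : ℕ => catalanPowCoeff 0 k * x ^ k) (catalanSum x ^ (0 + 1)) := by
    simpa [catalanPowCoeff_zero_left] using hasSum_catalanSum hx
  induction m using Nat.twoStepInduction with
  | zero => exact h0
  | one =>
    have h := ((hasSum_nat_add_iff' 1).2 h0).mul_left x⁻¹
    refine h.of_forall_eq (fun k => ?_) ?_
    · rw [catalanPowCoeff_one_left]
      field_simp
      ring
    · simp only [Finset.sum_range_one, catalanPowCoeff_zero_right]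
      field_simp
      linear_combination -hS
  | more m ih ih' =>
    have h := (((hasSum_nat_add_iff' 1).2 ih').sub ((hasSum_nat_add_iff' 1).2 ih)).mul_left x⁻¹
    refine h.of_forall_eq (fun k => ?_) ?_
    · rw [← catalanPowCoeff_add]
      field_simp
      ring
    · simp only [Finset.sum_range_one, catalanPowCoeff_zero_right]
      field_simp
      linear_combination -catalanSum x ^ (m + 1) * hS

theorem hasSum_catalanPowCoeff_prod {x y : ℝ} (hx : |x| ≤ 1 / 4) (hy : |y| < 1 / 2) :
    HasSum (fun p : ℕ × ℕ => catalanPowCoeff (p.1 + 1) p.2 * x ^ p.2 * y ^ p.1)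
      (catalanSum x ^ 2 * (1 - catalanSum x * y)⁻¹) := by
  have key : ∀ {u v : ℝ}, |u| ≤ 1 / 4 → |v| < 1 / 2 →
      HasSum (fun m : ℕ => catalanSum u ^ (m + 1 + 1) * v ^ m)
        (catalanSum u ^ 2 * (1 - catalanSum u * v)⁻¹) := by
    intro u v hu hv
    have : ‖catalanSum u * v‖ < 1 := by
      rw [norm_mul, Real.norm_eq_abs, Real.norm_eq_abs]
      nlinarith [abs_catalanSum_le_two hu, abs_nonneg v]
    exact ((hasSum_geometric_of_norm_lt_one this).mul_left (catalanSum u ^ 2)).of_forall_eq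
      (fun m => by ring) rfl
  have hfib : ∀ {u : ℝ} (v : ℝ), |u| ≤ 1 / 4 → ∀ m : ℕ,
      HasSum (fun k => catalanPowCoeff (m + 1) k * u ^ k * v ^ m)
        (catalanSum u ^ (m + 1 + 1) * v ^ m) :=
    fun v hu m => (hasSum_catalanPowCoeff hu (m + 1)).mul_right _
  have hx' : |(|x|)| ≤ 1 / 4 := by rwa [abs_abs]
  have hy' : |(|y|)| < 1 / 2 := by rwa [abs_abs]
  have hsum : Summable fun p : ℕ × ℕ => catalanPowCoeff (p.1 + 1) p.2 * x ^ p.2 * y ^ p.1 := by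
    apply Summable.of_norm
    have hnorm : (fun p : ℕ × ℕ => ‖catalanPowCoeff (p.1 + 1) p.2 * x ^ p.2 * y ^ p.1‖)
        = fun p : ℕ × ℕ => catalanPowCoeff (p.1 + 1) p.2 * |x| ^ p.2 * |y| ^ p.1 := by
      ext p
      simp [abs_of_nonneg (catalanPowCoeff_nonneg _ _)]
    rw [hnorm, summable_prod_of_nonneg fun p => by
      have := catalanPowCoeff_nonneg (p.1 + 1) p.2
      positivity]
    refine ⟨fun m => (hfib |y| hx' m).summable, ?_⟩
    simpa only [(hfib |y| hx' _).tsum_eq] using (key hx' hy').summable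
  rw [← (hsum.hasSum.prod_fiberwise fun m => hfib y hx m).unique (key hx hy)]
  exact hsum.hasSum


/-- The z → 1 functional equation of escalier polyominoes,
F(x,y) = 1 - (x/y)F(x,0) + (x/(y(1-y)))F(x,y) with F(x,0) = (1-√(1-4x))/(2x),
has solution F(x,y) = (1-y)(1-2y-√(1-4x))/(2(x-y+y²)), with coefficients
[xⁿy^m]F = (m+2)(2n+m-1)!/((n-1)!(n+m+1)!) for n ≥ 1, m ≥ 0 (and constant term 1). -/
theorem escalier_z_eq_one :
    let F : ℝ → ℝ → ℝ := fun x y =>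
      (1 - y) * (1 - 2*y - Real.sqrt (1 - 4*x)) / (2 * (x - y + y^2))
    let F₀ : ℝ → ℝ := fun x => (1 - Real.sqrt (1 - 4*x)) / (2*x)
    (∀ x y : ℝ, x ≠ 0 → y ≠ 0 → y ≠ 1 → x - y + y^2 ≠ 0 → 1 - 4*x ≥ 0 →
      F x y = 1 - (x/y) * F₀ x + (x / (y * (1 - y))) * F x y) ∧
    (∀ x : ℝ, x ≠ 0 → F x 0 = F₀ x) ∧
    (∀ x y : ℝ, |x| < 1/4 → |y| < 1/4 → x - y + y^2 ≠ 0 →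
      HasSum (fun p : ℕ × ℕ =>
          (((p.2 + 2) * Nat.factorial (2*(p.1+1) + p.2 - 1) : ℕ) : ℝ) /
            ((Nat.factorial p.1 : ℝ) * (Nat.factorial ((p.1+1) + p.2 + 1) : ℝ)) *
            x ^ (p.1 + 1) * y ^ p.2)
        (F x y - 1)) := by
  intro F F₀
  refine ⟨?_, ?_, ?_⟩
  · intro x y hx hy hy1 hxy hs
    have hy1' : 1 - y ≠ 0 := sub_ne_zero.2 hy1.symm
    simp only [F, F₀]
    field_simp
    ring
  · intro x hx
    simp [F, F₀]
  · intro x y hx hy hxy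
    have hS := catalanSum_eq hx.le
    have hS2 := abs_catalanSum_le_two hx.le
    have hSy : 1 - catalanSum x * y ≠ 0 := by
      have : |catalanSum x * y| < 1 := by
        rw [abs_mul]
        nlinarith [abs_nonneg y]
      linarith [le_abs_self (catalanSum x * y)]
    have hF : F x y - 1 = x * (catalanSum x ^ 2 * (1 - catalanSum x * y)⁻¹) := by
      simp only [F]
      rw [sqrt_one_sub_four_mul hx.le]
      have hI := inv_mul_cancel₀ hSy
      generalize (1 - catalanSum x * y)⁻¹ = I at hI ⊢
      generalize catalanSum x = c at hS hI ⊢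
      rw [sub_eq_iff_eq_add, div_eq_iff (mul_ne_zero two_ne_zero hxy)]
      linear_combination 2 * (x * c - y) * (-x * c) * hI +
        (2 * (x * c ^ 2 * I + 1) * x - 2 * (x * c - y) * x * c * I) * hS
    rw [hF, ← (Equiv.prodComm ℕ ℕ).hasSum_iff]
    refine ((hasSum_catalanPowCoeff_prod hx.le (hy.trans (by norm_num))).mul_left x).of_forall_eq
      ?_ rfl
    rintro ⟨m, k⟩
    simp only [Function.comp_apply, Equiv.prodComm_apply, Prod.swap, catalanPowCoeff]
    rw [show 2 * (k + 1) + m - 1 = 2 * k + (m + 1) by omega,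
      show k + 1 + m + 1 = k + (m + 1) + 1 by ring]
    push_cast
    ring
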